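/- arXiv:1905.10483 — 9 statements merged into one kernel-verified Lean document; each statement's English description precedes it below -/
import Mathlib

section
/- For all integers q ≥ s ≥ 2, R(s,q) ≤ 2^{q−1}; that is, every covering family of vectors in (ℤ/sℤ)^q has cardinality at most 2^{q−1}. -/
/-- A family `F` of vectors in `(ZMod s)^q` is covering if for every ordered pair of
distinct vectors `u, v ∈ F` and every `a : ZMod s` there is a coordinate `i` with
`u i - v i = a`. -/
def IsCoveringFamily (s q : ℕ) (F : Finset (Fin q → ZMod s)) : Prop :=
  ∀ u ∈ F, ∀ v ∈ F, u ≠ v → ∀ a : ZMod s, ∃ i : Fin q, u i - v i = a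

/-- `R s q` is the maximum possible cardinality of a covering family of vectors
in `(ZMod s)^q`. -/
noncomputable def R (s q : ℕ) : ℕ :=
  sSup {n : ℕ | ∃ F : Finset (Fin q → ZMod s), IsCoveringFamily s q F ∧ F.card = n}

/-- The function `x ↦ ∏ i, (x i - w i)`, where residues are represented by rationals. -/
def prodSub {s q : ℕ} (w x : Fin q → ZMod s) : ℚ :=
  ∏ i, (((x i).val : ℚ) - ((w i).val : ℚ))

theorem prodSub_eq_zero_iff {s q : ℕ} [NeZero s] (w x : Fin q → ZMod s) :
    prodSub w x = 0 ↔ ∃ i, x i = w i := by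
  simp only [prodSub, Finset.prod_eq_zero_iff, Finset.mem_univ, true_and, sub_eq_zero,
    Nat.cast_inj, (ZMod.val_injective s).eq_iff]

theorem prodSub_mem_span_monomials {s q : ℕ} (w : Fin q → ZMod s) :
    prodSub w ∈ Submodule.span ℚ (Set.range fun (t : Finset (Fin q)) (x : Fin q → ZMod s) =>
      ∏ i ∈ t, ((x i).val : ℚ)) := by
  have h : prodSub w = ∑ t : Finset (Fin q), (∏ i ∈ Finset.univ \ t, -((w i).val : ℚ)) •
      fun x : Fin q → ZMod s => ∏ i ∈ t, ((x i).val : ℚ) := by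
    ext x
    simp only [prodSub, sub_eq_add_neg, Finset.prod_add, Finset.powerset_univ,
      Finset.sum_apply, Pi.smul_apply, smul_eq_mul]
    exact Finset.sum_congr rfl fun t _ => mul_comm _ _
  rw [h]
  exact Submodule.sum_mem _ fun t _ =>
    Submodule.smul_mem _ _ (Submodule.subset_span ⟨t, rfl⟩)

theorem IsCoveringFamily.linearIndependent_prodSub {s q : ℕ} (hs : 2 ≤ s) (hq : 0 < q)
    {F : Finset (Fin q → ZMod s)} (hF : IsCoveringFamily s q F) :
    LinearIndependent ℚ
      (Sum.elim (fun v : F => prodSub (v.1 + 1)) (fun v : F => prodSub v.1)) := by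
  have : NeZero s := ⟨by omega⟩
  have : Fact (1 < s) := ⟨hs⟩
  rw [Fintype.linearIndependent_iff]
  intro g hg
  simp only [Fintype.sum_sum_type, Sum.elim_inl, Sum.elim_inr] at hg
  have eval (x : Fin q → ZMod s) : ∑ v : F, g (.inl v) * prodSub (v.1 + 1) x +
      ∑ v : F, g (.inr v) * prodSub v.1 x = 0 := by
    simpa using congrFun hg x
  have hl (u : F) : g (.inl u) = 0 := by
    have h := eval u
    rw [Finset.sum_eq_single u, Finset.sum_eq_zero, add_zero] at h
    · refine (mul_eq_zero.mp h).resolve_right fun h0 => ?_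
      simpa using (prodSub_eq_zero_iff _ _).mp h0
    · intro v _
      refine mul_eq_zero_of_right _ ((prodSub_eq_zero_iff _ _).mpr ?_)
      by_cases huv : u.1 = v.1
      · exact ⟨⟨0, hq⟩, by rw [huv]⟩
      · obtain ⟨i, hi⟩ := hF u.1 u.2 v.1 v.2 huv 0
        exact ⟨i, sub_eq_zero.mp hi⟩
    · intro v _ hvu
      refine mul_eq_zero_of_right _ ((prodSub_eq_zero_iff _ _).mpr ?_)
      obtain ⟨i, hi⟩ := hF u.1 u.2 v.1 v.2 (fun h => hvu (Subtype.ext h.symm)) 1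
      exact ⟨i, by simpa [add_comm] using sub_eq_iff_eq_add.mp hi⟩
    · simp
  have hr (u : F) : g (.inr u) = 0 := by
    have h := eval (u.1 + 1)
    simp only [hl, zero_mul, Finset.sum_const_zero, zero_add] at h
    rw [Finset.sum_eq_single u] at h
    · refine (mul_eq_zero.mp h).resolve_right fun h0 => ?_
      simpa using (prodSub_eq_zero_iff _ _).mp h0
    · intro v _ hvu
      refine mul_eq_zero_of_right _ ((prodSub_eq_zero_iff _ _).mpr ?_)
      obtain ⟨i, hi⟩ := hF u.1 u.2 v.1 v.2 (fun h => hvu (Subtype.ext h.symm)) (-1)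
      exact ⟨i, by simp [sub_eq_iff_eq_add.mp hi]⟩
    · simp
  rintro (u | u)
  exacts [hl u, hr u]

theorem IsCoveringFamily.two_mul_card_le {s q : ℕ} (hs : 2 ≤ s) (hq : 0 < q)
    {F : Finset (Fin q → ZMod s)} (hF : IsCoveringFamily s q F) : 2 * F.card ≤ 2 ^ q := by
  have : NeZero s := ⟨by omega⟩
  have hrank := finrank_span_eq_card (hF.linearIndependent_prodSub hs hq)
  have hle := (Submodule.finrank_mono (Submodule.span_le.mpr (by
    rintro _ ⟨v | v, rfl⟩
    exacts [prodSub_mem_span_monomials _, prodSub_mem_span_monomials _])) :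
      Module.finrank ℚ (Submodule.span ℚ (Set.range
        (Sum.elim (fun v : F => prodSub (v.1 + 1)) (fun v : F => prodSub v.1)))) ≤ _).trans
    (finrank_range_le_card (R := ℚ) fun (t : Finset (Fin q)) (x : Fin q → ZMod s) =>
      ∏ i ∈ t, ((x i).val : ℚ))
  simpa [hrank, two_mul] using hle

theorem covering_number_upper_bound :
    ∀ s q : ℕ, 2 ≤ s → s ≤ q → R s q ≤ 2 ^ (q - 1) := by
  intro s q hs hsq
  refine csSup_le ⟨0, ∅, by simp [IsCoveringFamily], rfl⟩ ?_
  rintro _ ⟨F, hF, rfl⟩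
  obtain ⟨n, rfl⟩ : ∃ n, q = n + 1 := ⟨q - 1, by omega⟩
  have h := hF.two_mul_card_le hs n.succ_pos
  rw [pow_succ] at h
  simp only [Nat.add_sub_cancel]
  omega
end

section
/- Let H be a finite bipartite graph with vertex classes A₁ and A₂, where |A₂| = n₂ ≥ 1, every vertex of A₁ has degree exactly d₁ in A₂, every vertex of A₂ has degree exactly d₂ in A₁, and d₂ ≥ log(2n₂) (natural logarithm). Then there exists a function f : A₂ → A₁ such that f(v) is adjacent to v for every v ∈ A₂, and for every u in the image of f the number of vertices v ∈ A₂ with f(v) = u is at least d₁/(4·log(2n₂)). (Equivalently, there is a union of vertex-disjoint stars with centers in A₁, each star having at least d₁/(4·log(2n₂)) leaves, such that every vertex of A₂ is a leaf of one of the stars.) -/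
open Finset in
/-- Fractional form of Hall's theorem with demands: if `y` is a fractional assignment of the
elements of `β` in which every index `i` receives weight at least `k i` from `t i`, then there are
disjoint sets `B i ⊆ t i` of size `k i`. -/
theorem exists_disjoint_subsets_of_fractional_assignment {ι β : Type*} [Fintype ι]
    [DecidableEq ι] [DecidableEq β] (t : ι → Finset β) (k : ι → ℕ) (y : ι → β → ℝ)
    (hy : ∀ i v, 0 ≤ y i v) (hload : ∀ v, ∑ i, y i v ≤ 1)
    (hdemand : ∀ i, (k i : ℝ) ≤ ∑ v ∈ t i, y i v) :
    ∃ B : ι → Finset β, (∀ i, B i ⊆ t i) ∧ (∀ i, #(B i) = k i) ∧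
      ∀ i j, i ≠ j → Disjoint (B i) (B j) := by
  obtain ⟨h, hinj, hmem⟩ := (Finset.all_card_le_biUnion_card_iff_exists_injective
    (fun p : Σ i, Fin (k i) => t p.1)).1 (by
      intro s
      set I := s.image Sigma.fst with hI
      set U := s.biUnion (fun p => t p.1) with hU
      have hs : s ⊆ I.sigma (fun _ => univ) := by
        intro p hp
        simp only [mem_sigma, mem_univ, and_true]
        exact mem_image_of_mem _ hp
      have hcard : #s ≤ ∑ i ∈ I, k i := by
        simpa using card_le_card hs
      have htU : ∀ i ∈ I, t i ⊆ U := by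
        intro i hi
        obtain ⟨p, hp, rfl⟩ := mem_image.1 hi
        exact subset_biUnion_of_mem (fun p : Σ i, Fin (k i) => t p.1) hp
      have : (#s : ℝ) ≤ #U := by
        calc (#s : ℝ) ≤ ∑ i ∈ I, (k i : ℝ) := by exact_mod_cast hcard
          _ ≤ ∑ i ∈ I, ∑ v ∈ U, y i v := by
            refine sum_le_sum fun i hi => (hdemand i).trans ?_
            exact sum_le_sum_of_subset_of_nonneg (htU i hi) fun v _ _ => hy i v
          _ = ∑ v ∈ U, ∑ i ∈ I, y i v := sum_comm
          _ ≤ ∑ v ∈ U, 1 := by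
            refine sum_le_sum fun v _ => le_trans ?_ (hload v)
            exact sum_le_sum_of_subset_of_nonneg (subset_univ _) fun i _ _ => hy i v
          _ = #U := by simp
      exact_mod_cast this)
  refine ⟨fun i => univ.image fun c : Fin (k i) => h ⟨i, c⟩, ?_, ?_, ?_⟩
  · intro i v hv
    obtain ⟨c, -, rfl⟩ := mem_image.1 hv
    exact hmem ⟨i, c⟩
  · intro i
    rw [card_image_of_injective _ fun c c' hc => by simpa using hinj hc]
    simp
  · intro i j hij
    rw [disjoint_left]
    rintro v hv hv'
    obtain ⟨c, -, rfl⟩ := mem_image.1 hv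
    obtain ⟨c', -, hc'⟩ := mem_image.1 hv'
    exact hij (congrArg Sigma.fst (hinj hc')).symm

/-- The set `W` can be partitioned into stars with at least `k` leaves each; the star centred at
`a` has its leaves in `N a`. -/
def HasStarPartition {α β : Type*} [DecidableEq α] (N : α → Finset β) (k : ℕ)
    (W : Finset β) : Prop :=
  ∃ f : β → α, ∀ v ∈ W, v ∈ N (f v) ∧ k ≤ (W.filter fun w => f w = f v).card

namespace HasStarPartition

open Finset

variable {α β : Type*} [DecidableEq α] [DecidableEq β] {N : α → Finset β} {k : ℕ}
  {W W' : Finset β}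

theorem union (hd : Disjoint W W') (h : HasStarPartition N k W) (h' : HasStarPartition N k W') :
    HasStarPartition N k (W ∪ W') := by
  obtain ⟨f, hf⟩ := h
  obtain ⟨f', hf'⟩ := h'
  have hW' : ∀ v ∈ W', v ∉ W := fun v hv hv' => disjoint_left.1 hd hv' hv
  refine ⟨fun v => if v ∈ W then f v else f' v, fun v hv => ?_⟩
  by_cases hvW : v ∈ W
  · simp only [hvW, if_true]
    refine ⟨(hf v hvW).1, (hf v hvW).2.trans (card_le_card fun w hw => ?_)⟩
    rw [mem_filter] at hw ⊢
    exact ⟨mem_union_left _ hw.1, by simp [hw.1, hw.2]⟩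
  · have hvW' : v ∈ W' := by simpa [hvW] using hv
    simp only [hvW, if_false]
    refine ⟨(hf' v hvW').1, (hf' v hvW').2.trans (card_le_card fun w hw => ?_)⟩
    rw [mem_filter] at hw ⊢
    exact ⟨mem_union_right _ hw.1, by simp [hW' w hw.1, hw.2]⟩

/-- Removing stars with at least `m` leaves greedily. -/
theorem exists_greedy [Nonempty α] (N : α → Finset β) {m : ℕ} (W : Finset β) :
    ∃ X ⊆ W, HasStarPartition N m (W \ X) ∧ ∀ a, #(N a ∩ X) ≤ m - 1 := by
  induction W using Finset.strongInduction with
  | H W ih =>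
    by_cases hW : ∀ a, #(N a ∩ W) ≤ m - 1
    · exact ⟨W, Subset.rfl, ⟨fun _ => Classical.arbitrary α, by simp⟩, hW⟩
    · push Not at hW
      obtain ⟨a, ha⟩ := hW
      have hne : (N a ∩ W).Nonempty := card_pos.1 (by omega)
      have hss : W \ N a ⊂ W := by
        refine Finset.ssubset_iff_subset_ne.2 ⟨sdiff_subset, fun h => ?_⟩
        obtain ⟨v, hv⟩ := hne
        rw [mem_inter] at hv
        rw [← h, mem_sdiff] at hv
        exact hv.2.2 hv.1
      obtain ⟨X, hX, hstar, hdeg⟩ := ih _ hss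
      refine ⟨X, hX.trans sdiff_subset, ?_, hdeg⟩
      have hsplit : W \ X = (N a ∩ W) ∪ ((W \ N a) \ X) := by
        ext v
        have := @hX v
        simp only [mem_sdiff, mem_union, mem_inter] at this ⊢
        tauto
      rw [hsplit]
      refine union ?_ ⟨fun _ => a, fun v hv => ⟨(mem_inter.1 hv).1, ?_⟩⟩ hstar
      · rw [disjoint_left]
        intro v hv hv'
        simp only [mem_sdiff, mem_inter] at hv hv'
        tauto
      · simp only [filter_true]
        omega

/-- A dominating set of centres of small degree yields a partition into large stars. -/
theorem of_dominating [Fintype α] [Fintype β] {d : ℕ} (hd : ∀ a, #(N a) = d) (S : Finset α) {Δ : ℝ}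
    (hΔ : 0 < Δ) (hS : ∀ v, ∃ a ∈ S, v ∈ N a)
    (hdeg : ∀ v, (#(S.filter fun a => v ∈ N a) : ℝ) ≤ Δ) (hk : k * Δ ≤ d) :
    HasStarPartition N k univ := by
  obtain ⟨B, hBsub, hBcard, hBdisj⟩ := exists_disjoint_subsets_of_fractional_assignment
    (fun a => N a) (fun a => if a ∈ S then k else 0)
    (fun a v => if a ∈ S ∧ v ∈ N a then Δ⁻¹ else 0)
    (fun a v => by positivity)
    (fun v => by
      rw [← sum_filter, sum_const, nsmul_eq_mul, ← div_eq_mul_inv, div_le_one hΔ]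
      have h : (univ.filter fun a => a ∈ S ∧ v ∈ N a) = S.filter fun a => v ∈ N a := by
        ext a
        simp
      rw [h]
      exact hdeg v)
    (fun a => by
      by_cases ha : a ∈ S
      · simp only [ha, if_true, true_and]
        rw [← sum_filter, filter_mem_eq_inter, inter_self, sum_const, hd, nsmul_eq_mul,
          ← div_eq_mul_inv, le_div_iff₀ hΔ]
        exact hk
      · simp [ha])
  choose g hgS hg using hS
  have hBS : ∀ a v, v ∈ B a → a ∈ S := by
    intro a v hv
    by_contra ha
    have := hBcard a
    rw [if_neg ha, card_eq_zero] at this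
    simp [this] at hv
  have hf : ∀ v, ∃ a ∈ S, v ∈ N a ∧ ∀ a', v ∈ B a' → a' = a := by
    intro v
    by_cases hv : ∃ a, v ∈ B a
    · obtain ⟨a, ha⟩ := hv
      refine ⟨a, hBS a v ha, hBsub a ha, fun a' ha' => ?_⟩
      by_contra hne
      exact disjoint_left.1 (hBdisj a' a hne) ha' ha
    · exact ⟨g v, hgS v, hg v, fun a' ha' => (hv ⟨a', ha'⟩).elim⟩
  choose f hfS hfN hfB using hf
  refine ⟨f, fun v _ => ⟨hfN v, ?_⟩⟩
  have hcard := hBcard (f v)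
  rw [if_pos (hfS v)] at hcard
  rw [← hcard]
  exact card_le_card fun w hw => by simpa using (hfB w _ hw).symm

/-- Extending a partition of `Y` into stars with at least `3 * k` leaves to `X ∪ Y`: each chosen
centre `g x`, `x ∈ X`, takes further leaves from the stars partitioning `Y`. -/
theorem union_of_choice [Fintype α] {X Y : Finset β} (hXY : Disjoint X Y)
    (hY : HasStarPartition N (3 * k) Y) (hk : 1 ≤ k) {g : β → α} (hg : ∀ x, x ∈ N (g x)) {Δ : ℝ}
    (hΔ : 0 < Δ) (hdeg : ∀ v, (#(X.filter fun x => v ∈ N (g x)) : ℝ) ≤ Δ)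
    (hlarge : ∀ a, ((k - 1 : ℕ) : ℝ) * Δ * 3 ≤ 2 * #(N a ∩ Y)) :
    HasStarPartition N k (X ∪ Y) := by
  obtain ⟨f, hf⟩ := hY
  set R := X.image g with hR
  set T := Y.image f with hT
  have hRdeg : ∀ v, (#(R.filter fun a => v ∈ N a) : ℝ) ≤ Δ := by
    intro v
    refine le_trans ?_ (hdeg v)
    rw [hR, filter_image]
    exact_mod_cast card_image_le
  obtain ⟨B, hBsub, hBcard, hBdisj⟩ := exists_disjoint_subsets_of_fractional_assignment
    (Sum.elim (fun a => N a ∩ Y) fun s => Y.filter fun v => f v = s)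
    (Sum.elim (fun a => if a ∈ R then k - 1 else 0) fun s => if s ∈ T then k else 0)
    (Sum.elim (fun a v => if a ∈ R ∧ v ∈ N a then 2 / 3 * Δ⁻¹ else 0)
      fun s v => if f v = s then 1 / 3 else 0)
    (by rintro (a | s) v <;> simp only [Sum.elim_inl, Sum.elim_inr] <;> positivity)
    (fun v => by
      simp only [Fintype.sum_sum_type, Sum.elim_inl, Sum.elim_inr, sum_ite_eq, mem_univ, if_true]
      rw [← sum_filter, sum_const, nsmul_eq_mul]
      have h : (univ.filter fun a => a ∈ R ∧ v ∈ N a) = R.filter fun a => v ∈ N a := by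
        ext a
        simp
      have h' : (#(R.filter fun a => v ∈ N a) : ℝ) * Δ⁻¹ ≤ 1 := by
        rw [← div_eq_mul_inv, div_le_one hΔ]
        exact hRdeg v
      rw [h]
      linarith)
    (by
      rintro (a | s)
      · simp only [Sum.elim_inl]
        by_cases ha : a ∈ R
        · simp only [ha, if_true, true_and]
          rw [← sum_filter, filter_true_of_mem fun v hv => (mem_inter.1 hv).1, sum_const,
            nsmul_eq_mul]
          have := hlarge a
          rw [← mul_assoc, ← div_eq_mul_inv, le_div_iff₀ hΔ]
          linarith
        · simp [ha]
      · simp only [Sum.elim_inr]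
        by_cases hs : s ∈ T
        · obtain ⟨v, hv, rfl⟩ := mem_image.1 hs
          rw [if_pos hs, ← sum_filter, filter_true_of_mem fun v hv => (mem_filter.1 hv).2,
            sum_const, nsmul_eq_mul]
          have : ((3 * k : ℕ) : ℝ) ≤ #(Y.filter fun w => f w = f v) := by
            exact_mod_cast (hf v hv).2
          push_cast at this
          linarith
        · simpa [hs] using sum_nonneg fun v _ => by positivity)
  have hBR : ∀ a v, v ∈ B (Sum.inl a) → a ∈ R := by
    intro a v hv
    by_contra ha
    have := hBcard (Sum.inl a)
    rw [Sum.elim_inl, if_neg ha, card_eq_zero] at this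
    simp [this] at hv
  have hBuniq : ∀ i j v, v ∈ B i → v ∈ B j → i = j := by
    intro i j v hi hj
    by_contra hne
    exact disjoint_left.1 (hBdisj i j hne) hi hj
  have hF : ∀ v, ∃ a, (v ∈ X → a = g v) ∧ (v ∈ Y → v ∈ N a ∧ (a ∈ R ∨ a ∈ T) ∧
      (∀ a', v ∈ B (Sum.inl a') → a' = a) ∧ ∀ s, v ∈ B (Sum.inr s) → s = a) := by
    intro v
    by_cases hvY : v ∈ Y
    · have hvX : v ∉ X := disjoint_right.1 hXY hvY
      by_cases hv : ∃ a, v ∈ B (Sum.inl a)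
      · obtain ⟨a, ha⟩ := hv
        refine ⟨a, fun h => (hvX h).elim, fun _ => ⟨(mem_inter.1 (hBsub _ ha)).1,
          Or.inl (hBR a v ha), fun a' ha' => Sum.inl_injective (hBuniq _ _ v ha' ha),
          fun s hs => ?_⟩⟩
        simpa using hBuniq _ _ v hs ha
      · exact ⟨f v, fun h => (hvX h).elim, fun _ => ⟨(hf v hvY).1,
          Or.inr (mem_image_of_mem _ hvY), fun a' ha' => (hv ⟨a', ha'⟩).elim,
          fun s hs => ((mem_filter.1 (hBsub _ hs)).2).symm⟩⟩
    · exact ⟨g v, fun _ => rfl, fun h => (hvY h).elim⟩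
  choose F hFX hFY using hF
  have hFR : ∀ a ∈ R, k ≤ #((X ∪ Y).filter fun w => F w = a) := by
    intro a ha
    obtain ⟨x, hx, rfl⟩ := mem_image.1 ha
    have hxB : x ∉ B (Sum.inl (g x)) := fun h =>
      disjoint_left.1 hXY hx (mem_inter.1 (hBsub _ h)).2
    have hcard := card_insert_of_notMem hxB
    rw [hBcard, Sum.elim_inl, if_pos ha] at hcard
    refine le_trans (by omega) (card_le_card (s := insert x (B (Sum.inl (g x)))) ?_)
    intro w hw
    rw [mem_filter, mem_union]
    obtain rfl | hw := mem_insert.1 hw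
    · exact ⟨Or.inl hx, hFX _ hx⟩
    · have hwY : w ∈ Y := (mem_inter.1 (hBsub _ hw)).2
      exact ⟨Or.inr hwY, ((hFY w hwY).2.2.1 _ hw).symm⟩
  have hFT : ∀ a ∈ T, k ≤ #((X ∪ Y).filter fun w => F w = a) := by
    intro a ha
    have hcard := hBcard (Sum.inr a)
    rw [Sum.elim_inr, if_pos ha] at hcard
    rw [← hcard]
    refine card_le_card fun w hw => ?_
    have hwY : w ∈ Y := (mem_filter.1 (hBsub _ hw)).1
    rw [mem_filter, mem_union]
    exact ⟨Or.inr hwY, ((hFY w hwY).2.2.2 _ hw).symm⟩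
  refine ⟨F, fun v hv => ?_⟩
  obtain hv | hv := mem_union.1 hv
  · rw [hFX v hv]
    exact ⟨hg v, hFR _ (mem_image_of_mem _ hv)⟩
  · obtain ⟨hN, hRT, -⟩ := hFY v hv
    exact ⟨hN, hRT.elim (hFR _) (hFT _)⟩

end HasStarPartition

section Probabilistic

open Finset Real

variable {α β : Type*} [Fintype α] [DecidableEq β] {N : α → Finset β} {d : ℕ}

/-- Choosing independently a uniformly random neighbour `g x` of every `x`, no vertex is adjacent
to many of the chosen vertices. -/
theorem exists_choice_of_card_inter_le [Fintype β]
    (hd : ∀ v, #(univ.filter fun a => v ∈ N a) = d) (hdpos : 0 < d) (X : Finset β)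
    {j : ℕ} (hj : ∀ a, #(N a ∩ X) ≤ j) {θ : ℝ}
    (hθ : Fintype.card β * exp (j * (exp 1 - 1)) < exp θ) :
    ∃ g : β → α, (∀ x, x ∈ N (g x)) ∧ ∀ v, (#(X.filter fun x => v ∈ N (g x)) : ℝ) < θ := by
  have he : 0 ≤ exp 1 - 1 := by linarith [add_one_le_exp (1 : ℝ)]
  have hd' : (0 : ℝ) < d := by exact_mod_cast hdpos
  set P := Fintype.piFinset fun x : β => univ.filter fun a => x ∈ N a with hP
  have hcard : (#P : ℝ) = ∏ _x : β, (d : ℝ) := by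
    simp [hP, Fintype.card_piFinset, hd]
  have hgen : ∀ v, ∑ g ∈ P, exp (#(X.filter fun x => v ∈ N (g x)))
      ≤ #P * exp (j * (exp 1 - 1)) := by
    intro v
    have hpow : ∀ g : β → α, exp (#(X.filter fun x => v ∈ N (g x)))
        = ∏ x, if x ∈ X ∧ v ∈ N (g x) then exp 1 else 1 := by
      intro g
      rw [prod_ite, prod_const_one, mul_one, prod_const, ← exp_nat_mul, mul_one]
      congr 3
      ext x
      simp
    simp only [hpow]
    rw [hP, ← prod_univ_sum (fun x : β => univ.filter fun a => x ∈ N a)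
      (fun x a => if x ∈ X ∧ v ∈ N a then exp 1 else 1), ← hP, hcard]
    set m : β → ℕ := fun x => #(univ.filter fun a => x ∈ N a ∧ x ∈ X ∧ v ∈ N a) with hm
    have hsum : ∑ x, m x ≤ d * j := by
      have hswap := sum_card_bipartiteAbove_eq_sum_card_bipartiteBelow
        (s := (univ : Finset β)) (t := (univ : Finset α))
        (fun x a => x ∈ N a ∧ x ∈ X ∧ v ∈ N a)
      simp only [bipartiteAbove, bipartiteBelow] at hswap
      rw [hm, hswap, ← hd v, card_filter, sum_mul]
      refine sum_le_sum fun a _ => ?_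
      by_cases ha : v ∈ N a
      · simp only [ha, and_true, if_true, one_mul]
        refine le_trans (le_of_eq ?_) (hj a)
        congr 1
        ext x
        simp
      · simp [ha]
    calc ∏ x, ∑ a ∈ univ.filter (fun a => x ∈ N a), (if x ∈ X ∧ v ∈ N a then exp 1 else 1)
        ≤ ∏ x, ((d : ℝ) * exp (m x / d * (exp 1 - 1))) := by
          refine prod_le_prod (fun x _ => sum_nonneg fun a _ => by positivity) fun x _ => ?_
          have h : ∑ a ∈ univ.filter (fun a => x ∈ N a),
              (if x ∈ X ∧ v ∈ N a then exp 1 else 1) = d + m x * (exp 1 - 1) := by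
            have h' : ∀ a, (if x ∈ X ∧ v ∈ N a then exp 1 else 1)
                = 1 + if x ∈ X ∧ v ∈ N a then exp 1 - 1 else 0 := by
              intro a
              split_ifs <;> ring
            simp only [h']
            rw [sum_add_distrib, ← sum_filter, filter_filter, sum_const, sum_const, hd]
            simp [hm]
          rw [h]
          have h'' := add_one_le_exp (m x / d * (exp 1 - 1))
          calc (d : ℝ) + m x * (exp 1 - 1) = d * (m x / d * (exp 1 - 1) + 1) := by
                field_simp
                ring
            _ ≤ _ := mul_le_mul_of_nonneg_left h'' hd'.le
      _ = (∏ _x : β, (d : ℝ)) * exp ((∑ x, (m x : ℝ)) / d * (exp 1 - 1)) := by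
          rw [prod_mul_distrib, ← exp_sum, sum_div, sum_mul]
      _ ≤ (∏ _x : β, (d : ℝ)) * exp (j * (exp 1 - 1)) := by
          have : (∑ x, (m x : ℝ)) / d ≤ j := by
            rw [div_le_iff₀ hd', mul_comm]
            exact_mod_cast hsum
          gcongr
  have hPpos : (0 : ℝ) < #P := by
    rw [hcard]
    exact prod_pos fun _ _ => hd'
  obtain ⟨g, hg, hlt⟩ : ∃ g ∈ P, ∑ v, exp (#(X.filter fun x => v ∈ N (g x))) < exp θ := by
    refine exists_lt_of_sum_lt ?_
    rw [sum_comm, sum_const, nsmul_eq_mul]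
    calc ∑ v, ∑ g ∈ P, exp (#(X.filter fun x => v ∈ N (g x)))
        ≤ ∑ _v : β, #P * exp (j * (exp 1 - 1)) := sum_le_sum fun v _ => hgen v
      _ = #P * (Fintype.card β * exp (j * (exp 1 - 1))) := by
          rw [sum_const, card_univ, nsmul_eq_mul]
          ring
      _ < #P * exp θ := mul_lt_mul_of_pos_left hθ hPpos
  refine ⟨g, fun x => by simpa using Fintype.mem_piFinset.1 hg x, fun v => ?_⟩
  rw [← exp_lt_exp]
  exact (single_le_sum (f := fun v => exp (#(X.filter fun x => v ∈ N (g x)) : ℝ))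
    (fun _ _ => (exp_pos _).le) (mem_univ v)).trans_lt hlt

/-- The generating function of the degree of `v` into a random set of vertices that contains
every vertex independently with probability `p`. -/
theorem sum_weight_mul_pow_card_le [DecidableEq α]
    (hd : ∀ v, #(univ.filter fun a => v ∈ N a) = d) {p c : ℝ}
    (hp₀ : 0 ≤ p) (hp₁ : p ≤ 1) (hc : 0 ≤ c) (v : β) :
    ∑ S : Finset α, ((∏ _a ∈ S, p) * ∏ _a ∈ Sᶜ, (1 - p)) * c ^ #(S.filter fun a => v ∈ N a)
      ≤ exp (d * p * (c - 1)) := by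
  have hpow : ∀ S : Finset α, c ^ #(S.filter fun a => v ∈ N a)
      = ∏ a ∈ S, if v ∈ N a then c else 1 := by
    intro S
    rw [prod_ite, prod_const_one, mul_one, prod_const]
  have hterm : ∀ S : Finset α, ((∏ _a ∈ S, p) * ∏ _a ∈ Sᶜ, (1 - p))
      * c ^ #(S.filter fun a => v ∈ N a)
      = (∏ a ∈ S, p * if v ∈ N a then c else 1) * ∏ _a ∈ Sᶜ, (1 - p) := by
    intro S
    rw [hpow, prod_mul_distrib]
    ring
  simp only [hterm]
  rw [← Fintype.prod_add (fun a => p * if v ∈ N a then c else 1) fun _ => 1 - p]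
  have hfac : ∀ a, (p * if v ∈ N a then c else 1) + (1 - p)
      = if v ∈ N a then p * (c - 1) + 1 else 1 := by
    intro a
    split_ifs <;> ring
  simp only [hfac]
  rw [prod_ite, prod_const_one, mul_one, prod_const, hd, mul_assoc, exp_nat_mul]
  exact pow_le_pow_left₀ (by nlinarith) (add_one_le_exp _) _

/-- If the degree `d` is at least `L` and `2 * card β ≤ exp L`, some set of vertices dominates all
of `β` with degrees at most `3 * L`. -/
theorem exists_dominating_of_le_degree [Fintype β] [DecidableEq α]
    (hd : ∀ v, #(univ.filter fun a => v ∈ N a) = d) {L : ℝ} (hL : 0 < L)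
    (hLd : L ≤ d) (hcard : 2 * Fintype.card β ≤ exp L) :
    ∃ S : Finset α, (∀ v, ∃ a ∈ S, v ∈ N a) ∧
      ∀ v, (#(S.filter fun a => v ∈ N a) : ℝ) ≤ 3 * L := by
  have hd' : (0 : ℝ) < d := hL.trans_le hLd
  set p := L / d with hp
  have hp₀ : 0 ≤ p := by positivity
  have hp₁ : p ≤ 1 := (div_le_one hd').2 hLd
  have hdp : d * p = L := by rw [hp]; field_simp
  set w : Finset α → ℝ := fun S => (∏ _a ∈ S, p) * ∏ _a ∈ Sᶜ, (1 - p) with hw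
  have hwsum : ∑ S, w S = 1 := by
    rw [hw, ← Fintype.prod_add (fun _ : α => p) fun _ => 1 - p]
    simp
  have hwnonneg : ∀ S, 0 ≤ w S := fun S =>
    mul_nonneg (prod_nonneg fun _ _ => hp₀) (prod_nonneg fun _ _ => sub_nonneg.2 hp₁)
  set D : Finset α → β → ℕ := fun S v => #(S.filter fun a => v ∈ N a) with hD
  set Φ : Finset α → β → ℝ := fun S v => 0 ^ D S v + exp (-(3 * L)) * exp 1 ^ D S v with hΦ
  have hΦnonneg : ∀ S v, 0 ≤ Φ S v := fun S v => by positivity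
  have hexp : ∀ v, ∑ S, w S * Φ S v < 2 * exp (-L) := by
    intro v
    have h0 := sum_weight_mul_pow_card_le hd hp₀ hp₁ le_rfl v
    have h1 := sum_weight_mul_pow_card_le hd hp₀ hp₁ (exp_pos 1).le v
    rw [hdp] at h0 h1
    have hsplit : ∑ S, w S * Φ S v = ∑ S, w S * 0 ^ D S v
        + exp (-(3 * L)) * ∑ S, w S * exp 1 ^ D S v := by
      rw [mul_sum, ← sum_add_distrib]
      exact sum_congr rfl fun S _ => by rw [hΦ]; ring
    have h2 : exp (-(3 * L)) * exp (L * (exp 1 - 1)) < exp (-L) := by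
      rw [← exp_add, exp_lt_exp]
      nlinarith [exp_one_lt_d9]
    rw [hsplit]
    have h3 := mul_le_mul_of_nonneg_left h1 (exp_pos (-(3 * L))).le
    have h4 : exp (L * (0 - 1)) = exp (-L) := by congr 1; ring
    rw [h4] at h0
    change ∑ S, w S * 0 ^ D S v ≤ _ at h0
    change exp (-(3 * L)) * ∑ S, w S * exp 1 ^ D S v ≤ _ at h3
    linarith
  rcases isEmpty_or_nonempty β with hβ | hβ
  · exact ⟨∅, fun v => hβ.elim v, fun v => hβ.elim v⟩
  obtain ⟨S, -, hS⟩ : ∃ S ∈ (univ : Finset (Finset α)), w S * ∑ v, Φ S v < w S := by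
    refine exists_lt_of_sum_lt ?_
    rw [hwsum]
    simp only [mul_sum]
    rw [sum_comm]
    calc ∑ v, ∑ S, w S * Φ S v < ∑ _v : β, 2 * exp (-L) :=
          sum_lt_sum_of_nonempty univ_nonempty fun v _ => hexp v
      _ = 2 * Fintype.card β * exp (-L) := by
          rw [sum_const, card_univ, nsmul_eq_mul]
          ring
      _ ≤ exp L * exp (-L) := mul_le_mul_of_nonneg_right hcard (exp_pos _).le
      _ = 1 := by rw [← exp_add]; simp
  have hlt : ∀ v, Φ S v < 1 := by
    intro v
    have hsum : ∑ v, Φ S v < 1 := by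
      by_contra! h
      exact absurd hS (not_lt.2 (le_mul_of_one_le_right (hwnonneg S) h))
    exact (single_le_sum (f := Φ S) (fun v _ => hΦnonneg S v) (mem_univ v)).trans_lt hsum
  refine ⟨S, fun v => ?_, fun v => ?_⟩
  · by_contra! h
    have h0 : D S v = 0 := by
      rw [hD, card_eq_zero, filter_eq_empty_iff]
      exact fun a ha => h a ha
    have := hlt v
    simp only [hΦ, h0, pow_zero] at this
    linarith [exp_pos (-(3 * L))]
  · have h1 : exp (-(3 * L)) * exp 1 ^ D S v < 1 :=
      lt_of_le_of_lt (le_add_of_nonneg_left (pow_nonneg le_rfl _)) (hlt v)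
    rw [← exp_nat_mul, ← exp_add, exp_lt_one_iff, mul_one] at h1
    change (D S v : ℝ) ≤ 3 * L
    linarith

end Probabilistic

/-- By convexity of `exp`, an upper bound `exp x ≤ c * x` at `x = m` extends to all
`x ∈ [log 2, m]`. -/
theorem lt_of_mul_lt_exp {c m L : ℝ} (hc : 8 ≤ c) (hm : 1 < m) (hcm : Real.exp m ≤ c * m)
    (hL : Real.log 2 ≤ L) (h : c * L < Real.exp L) : m < L := by
  have he := Real.exp_one_lt_d9
  have hlog2 := Real.log_two_gt_d9
  by_contra! hLm
  rcases le_or_gt L 1 with hL1 | hL1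
  · have := Real.exp_le_exp.2 hL1
    nlinarith
  · have hm0 : 0 < m - 1 := by linarith
    have ha : 0 ≤ (m - L) / (m - 1) := div_nonneg (by linarith) hm0.le
    have hb : 0 ≤ (L - 1) / (m - 1) := div_nonneg (by linarith) hm0.le
    have hab : (m - L) / (m - 1) + (L - 1) / (m - 1) = 1 := by field_simp; ring
    have hconv := convexOn_exp.2 (Set.mem_univ 1) (Set.mem_univ m) ha hb hab
    have hcomb : (m - L) / (m - 1) * 1 + (L - 1) / (m - 1) * m = L := by field_simp; ring
    simp only [smul_eq_mul] at hconv
    rw [hcomb] at hconv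
    have h1 : (m - L) / (m - 1) * Real.exp 1 ≤ (m - L) / (m - 1) * (c * 1) :=
      mul_le_mul_of_nonneg_left (by linarith) ha
    have h2 : (L - 1) / (m - 1) * Real.exp m ≤ (L - 1) / (m - 1) * (c * m) :=
      mul_le_mul_of_nonneg_left hcm hb
    have h3 : (m - L) / (m - 1) * (c * 1) + (L - 1) / (m - 1) * (c * m) = c * L := by
      linear_combination c * hcomb
    linarith

open Finset Real in
theorem hasStarPartition_univ {α β : Type*} [Fintype α] [Fintype β] [Nonempty α] [DecidableEq α]
    [DecidableEq β] {N : α → Finset β} {k d₁ d₂ : ℕ} {L : ℝ}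
    (h₁ : ∀ a, #(N a) = d₁) (h₂ : ∀ v, #(univ.filter fun a => v ∈ N a) = d₂)
    (hL : log 2 ≤ L) (hexp : exp L = 2 * Fintype.card β) (hLd : L ≤ d₂)
    (hk : 2 ≤ k) (hd₁ : 4 * L * (k - 1) < d₁) : HasStarPartition N k univ := by
  have hLpos : 0 < L := lt_of_lt_of_le (log_pos one_lt_two) hL
  have hd₂ : 0 < d₂ := by exact_mod_cast hLpos.trans_le hLd
  rcases le_or_gt 4 k with hk4 | hk4
  · obtain ⟨S, hS, hdeg⟩ := exists_dominating_of_le_degree h₂ hLpos hLd hexp.ge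
    refine HasStarPartition.of_dominating h₁ S (by positivity) hS hdeg ?_
    have : (4 : ℝ) ≤ k := by exact_mod_cast hk4
    nlinarith
  obtain ⟨W, -, hY, hW⟩ := HasStarPartition.exists_greedy (m := 3 * k) N univ
  obtain ⟨X, hXW, hZ, hX⟩ := HasStarPartition.exists_greedy (m := k) N W
  set Y := univ \ W with hYdef
  have hdW : ∀ a, (d₁ : ℝ) - (3 * k - 1) ≤ #(N a ∩ Y) := by
    intro a
    have h := card_inter_add_card_sdiff (N a) W
    have hsub : N a \ W = N a ∩ Y := by ext v; simp [hYdef]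
    rw [hsub, h₁] at h
    have h' := hW a
    have : d₁ + 1 ≤ #(N a ∩ Y) + 3 * k := by omega
    have : (d₁ : ℝ) + 1 ≤ #(N a ∩ Y) + 3 * k := by exact_mod_cast this
    linarith
  have hd₁card : (d₁ : ℝ) ≤ Fintype.card β := by
    rw [← h₁ (Classical.arbitrary α)]
    exact_mod_cast card_le_univ _
  have hXY : Disjoint X Y := (disjoint_sdiff (s := W)).mono_left hXW
  have he := exp_one_lt_d9
  have he' := exp_one_gt_d9
  have hcard : (Fintype.card β : ℝ) ≤ exp (L - 1 / 2) := by
    have h2 : exp (1 / 2) ≤ 2 := by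
      have : exp (1 / 2) * exp (1 / 2) = exp 1 := by rw [← exp_add]; norm_num
      nlinarith [exp_pos (1 / 2 : ℝ)]
    have h3 : exp (L - 1 / 2) * exp (1 / 2) = 2 * Fintype.card β := by
      rw [← exp_add, ← hexp]; congr 1; ring
    nlinarith [exp_pos (L - 1 / 2)]
  suffices h : ∃ θ : ℝ, 0 < θ ∧ ((k - 1 : ℕ) : ℝ) * θ * 3 ≤ 2 * (d₁ - (3 * k - 1)) ∧
      L - 1 / 2 + ((k - 1 : ℕ) : ℝ) * (exp 1 - 1) < θ by
    obtain ⟨θ, hθ, hθd, hθL⟩ := h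
    obtain ⟨g, hg, hgdeg⟩ := exists_choice_of_card_inter_le h₂ hd₂ X hX (θ := θ) (by
      refine lt_of_le_of_lt (mul_le_mul_of_nonneg_right hcard (exp_pos _).le) ?_
      rw [← exp_add, exp_lt_exp]
      exact hθL)
    have hXYstar := HasStarPartition.union_of_choice hXY hY (by omega) hg hθ
      (fun v => (hgdeg v).le) fun a => hθd.trans (by linarith [hdW a])
    have huniv : (univ : Finset β) = (X ∪ Y) ∪ (W \ X) := by
      ext v
      simp only [hYdef, mem_univ, mem_union, mem_sdiff, true_iff, true_and]
      tauto
    rw [huniv]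
    refine HasStarPartition.union ?_ hXYstar hZ
    rw [disjoint_left]
    intro v hv hv'
    simp only [hYdef, mem_univ, mem_union, mem_sdiff, true_and] at hv hv'
    tauto
  have hexp4 : exp 4 ≤ 64 := by
    have h : exp 4 = exp 1 ^ 4 := by rw [← exp_nat_mul]; norm_num
    rw [h]
    calc exp 1 ^ 4 ≤ 2.72 ^ 4 := by gcongr; linarith
      _ ≤ 64 := by norm_num
  have hexp3 : exp 3 ≤ 24 := by
    have h : exp 3 = exp 1 ^ 3 := by rw [← exp_nat_mul]; norm_num
    rw [h]
    calc exp 1 ^ 3 ≤ 2.72 ^ 3 := by gcongr; linarith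
      _ ≤ 24 := by norm_num
  obtain rfl | rfl : k = 2 ∨ k = 3 := by omega
  · norm_num at hd₁
    have hL3 : 3 < L := lt_of_mul_lt_exp (c := 8) le_rfl (by norm_num) (by linarith) hL
      (by linarith)
    refine ⟨2 * (d₁ - 5) / 3, by linarith, by norm_num, by norm_num; linarith⟩
  · norm_num at hd₁
    have hL4 : 4 < L := lt_of_mul_lt_exp (c := 16) (by norm_num) (by norm_num) (by linarith) hL
      (by linarith)
    refine ⟨(d₁ - 8) / 3, by linarith, ?_, ?_⟩ <;> norm_num <;> linarith

theorem disjoint_stars_in_biregular_bipartite_graph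
    {A₁ A₂ : Type*} [Fintype A₁] [Fintype A₂] (Adj : A₁ → A₂ → Prop)
    (n₂ d₁ d₂ : ℕ)
    (hn₂ : n₂ = Fintype.card A₂) (hn₂pos : 1 ≤ n₂)
    (hdeg₁ : ∀ a : A₁, Nat.card {b : A₂ // Adj a b} = d₁)
    (hdeg₂ : ∀ b : A₂, Nat.card {a : A₁ // Adj a b} = d₂)
    (hlog : Real.log (2 * n₂) ≤ (d₂ : ℝ)) :
    ∃ f : A₂ → A₁, (∀ b : A₂, Adj (f b) b) ∧
      ∀ a : A₁, a ∈ Set.range f →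
        (d₁ : ℝ) / (4 * Real.log (2 * n₂)) ≤ (Nat.card {b : A₂ // f b = a} : ℝ) := by
  classical
  set L := Real.log (2 * n₂) with hLdef
  have hn₂' : (1 : ℝ) ≤ n₂ := by exact_mod_cast hn₂pos
  have hL : Real.log 2 ≤ L := Real.log_le_log two_pos (by linarith)
  have hLpos : 0 < L := lt_of_lt_of_le (Real.log_pos one_lt_two) hL
  have hd₂ : 0 < d₂ := by exact_mod_cast hLpos.trans_le hlog
  have hnbr : ∀ b, ∃ a, Adj a b := fun b => by
    have : 0 < Nat.card {a : A₁ // Adj a b} := by rw [hdeg₂]; exact hd₂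
    obtain ⟨⟨a, ha⟩⟩ := (Nat.card_pos_iff.1 this).1
    exact ⟨a, ha⟩
  have hcardfib : ∀ (f : A₂ → A₁) (a : A₁),
      Nat.card {b : A₂ // f b = a} = (Finset.univ.filter fun b => f b = a).card := fun f a => by
    rw [Nat.card_eq_fintype_card, Fintype.card_subtype]
  by_cases hsmall : (d₁ : ℝ) / (4 * L) ≤ 1
  · choose f hf using hnbr
    refine ⟨f, hf, ?_⟩
    rintro _ ⟨b, rfl⟩
    refine hsmall.trans ?_
    rw [hcardfib]
    exact_mod_cast Finset.card_pos.2 ⟨b, by simp⟩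
  push Not at hsmall
  obtain ⟨b₀⟩ : Nonempty A₂ := Fintype.card_pos_iff.1 (by omega)
  obtain ⟨a₀, -⟩ := hnbr b₀
  have : Nonempty A₁ := ⟨a₀⟩
  have hk : 1 < ⌈(d₁ : ℝ) / (4 * L)⌉₊ := Nat.lt_ceil.2 (by exact_mod_cast hsmall)
  have hceil := Nat.ceil_lt_add_one (zero_le_one.trans hsmall.le)
  obtain ⟨f, hf⟩ := hasStarPartition_univ (α := A₁) (β := A₂)
    (N := fun a => Finset.univ.filter fun b => Adj a b) (k := ⌈(d₁ : ℝ) / (4 * L)⌉₊)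
    (d₁ := d₁) (d₂ := d₂) (L := L)
    (fun a => by rw [← hdeg₁ a, Nat.card_eq_fintype_card, Fintype.card_subtype])
    (fun b => by simp [← hdeg₂ b, Nat.card_eq_fintype_card, Fintype.card_subtype])
    hL (by rw [hLdef, Real.exp_log (by linarith), hn₂]) hlog hk (by
      rw [mul_comm, ← lt_div_iff₀ (by positivity)]
      linarith)
  refine ⟨f, fun b => by simpa using (hf b (Finset.mem_univ b)).1, ?_⟩
  rintro _ ⟨b, rfl⟩
  rw [hcardfib]
  exact (Nat.le_ceil _).trans (by exact_mod_cast (hf b (Finset.mem_univ b)).2)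
end

section
/- Fix an integer s ≥ 2 and an integer q ≥ 1, and let F be a {0,1}-covering family of vectors in (ℤ/sℤ)^q. Then |F| ≤ 2^{q−1}. -/
/-- If the products `∏ i, (x k i - y l i)` vanish for `k ≠ l` and are units for `k = l`, then there
are at most `2 ^ |ι|` indices `k`, because these products factor through the multilinear monomials. -/
theorem card_le_two_pow_of_prod_sub {R ι κ : Type*} [CommRing R] [Nontrivial R] [Fintype ι]
    [Fintype κ] (x y : κ → ι → R) (hdiag : ∀ k, IsUnit (∏ i, (x k i - y k i)))
    (hoff : ∀ k l, k ≠ l → ∏ i, (x k i - y l i) = 0) :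
    Fintype.card κ ≤ 2 ^ Fintype.card ι := by
  classical
  let A : Matrix κ (Finset ι) R := fun k t => ∏ i ∈ t, x k i
  let B : Matrix (Finset ι) κ R := fun t l => ∏ i ∈ tᶜ, -y l i
  have hAB : A * B = Matrix.diagonal fun k => ∏ i, (x k i - y k i) := by
    ext k l
    have hprod : (A * B) k l = ∏ i, (x k i - y l i) := by
      simp only [sub_eq_add_neg, Fintype.prod_add]
      exact Matrix.mul_apply
    rw [hprod, Matrix.diagonal_apply]
    split_ifs with h
    · rw [h]
    · exact hoff k l h
  have hinj : Function.Injective B.mulVecLin := by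
    intro c d hcd
    have h : (A * B).mulVec c = (A * B).mulVec d := by
      simpa only [Matrix.mulVecLin_apply, Matrix.mulVec_mulVec] using congrArg A.mulVec hcd
    ext k
    have hk := congrFun h k
    rw [hAB, Matrix.mulVec_diagonal, Matrix.mulVec_diagonal] at hk
    exact (hdiag k).mul_left_cancel hk
  simpa using card_le_of_injective R B.mulVecLin hinj

theorem zero_one_covering_family_card_le
    (s q : ℕ) (hs : 2 ≤ s) (hq : 1 ≤ q) (F : Finset (Fin q → ZMod s))
    (hF : ∀ u ∈ F, ∀ v ∈ F, u ≠ v →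
      (∃ i : Fin q, u i - v i = 0) ∧ (∃ i : Fin q, u i - v i = 1)) :
    F.card ≤ 2 ^ (q - 1) := by
  have : Fact (1 < s) := ⟨hs⟩
  have hzero : ∀ u ∈ F, ∀ v ∈ F, ∃ i, u i - v i = 0 := by
    intro u hu v hv
    by_cases h : u = v
    · exact ⟨⟨0, hq⟩, by rw [h, sub_self]⟩
    · exact (hF u hu v hv h).1
  -- The points of `F` and of its translate `F + 1`, paired crosswise.
  let x : F × Bool → Fin q → ZMod s := fun k i => k.1.1 i + if k.2 then 1 else 0
  let y : F × Bool → Fin q → ZMod s := fun k i => k.1.1 i + if k.2 then 0 else 1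
  have hcard := card_le_two_pow_of_prod_sub x y ?_ ?_
  · rw [Fintype.card_prod, Fintype.card_coe, Fintype.card_bool, Fintype.card_fin] at hcard
    obtain ⟨n, rfl⟩ := Nat.exists_eq_add_of_le' hq
    rw [pow_succ] at hcard
    exact Nat.le_of_mul_le_mul_right hcard two_pos
  · rintro ⟨u, b⟩
    cases b <;> simp [x, y, IsUnit.pow]
  · rintro ⟨⟨u, hu⟩, b⟩ ⟨⟨v, hv⟩, c⟩ hne
    suffices h : ∃ i, x (⟨u, hu⟩, b) i - y (⟨v, hv⟩, c) i = 0 from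
      h.elim fun i hi => Finset.prod_eq_zero (Finset.mem_univ i) hi
    obtain ⟨i, hi⟩ := hzero u hu v hv
    cases b <;> cases c
    · obtain ⟨j, hj⟩ := (hF u hu v hv (by rintro rfl; exact hne rfl)).2
      exact ⟨j, by simp [x, y]; linear_combination hj⟩
    · exact ⟨i, by simpa [x, y] using hi⟩
    · exact ⟨i, by simpa [x, y] using hi⟩
    · obtain ⟨j, hj⟩ := (hF v hv u hu (by rintro rfl; exact hne rfl)).2
      exact ⟨j, by simp [x, y]; linear_combination -hj⟩
end

section
/- For every integer s ≥ 2, R(s,s) ≤ s; that is, every covering family of vectors in (ℤ/sℤ)^s has cardinality at most s. -/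
/-- In a covering family of vectors of length `s`, the images of distinct vectors under a nontrivial
additive character are orthogonal. -/
lemma IsCoveringFamily.sum_stdAddChar_sub_eq_zero {s : ℕ} [NeZero s] (hs : 2 ≤ s)
    {F : Finset (Fin s → ZMod s)} (hF : IsCoveringFamily s s F) {u v : Fin s → ZMod s}
    (hu : u ∈ F) (hv : v ∈ F) (huv : u ≠ v) :
    ∑ i, ZMod.stdAddChar (u i - v i) = (0 : ℂ) := by
  have : Fact (1 < s) := ⟨hs⟩
  have hbij : Function.Bijective fun i => u i - v i :=
    (Fintype.bijective_iff_surjective_and_card _).2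
      ⟨hF u hu v hv huv, by simp [ZMod.card]⟩
  rw [hbij.sum_comp fun a => (ZMod.stdAddChar a : ℂ)]
  refine AddChar.sum_eq_zero_of_ne_one fun h => one_ne_zero (α := ZMod s) ?_
  exact ZMod.injective_stdAddChar (by simp [h])

lemma IsCoveringFamily.card_le {s : ℕ} (hs : 2 ≤ s) {F : Finset (Fin s → ZMod s)}
    (hF : IsCoveringFamily s s F) : F.card ≤ s := by
  have : NeZero s := ⟨by omega⟩
  let w : F → EuclideanSpace ℂ (Fin s) := fun u =>
    WithLp.toLp 2 fun i => ZMod.stdAddChar (u.1 i)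
  have hw : LinearIndependent ℂ w := by
    refine linearIndependent_of_ne_zero_of_inner_eq_zero (𝕜 := ℂ) (fun u h => ?_)
      fun u v huv => ?_
    · have h0 : (ZMod.stdAddChar (u.1 0) : ℂ) = 0 := congrArg (fun x => x 0) h
      exact (AddChar.val_isUnit _ _).ne_zero h0
    · rw [← hF.sum_stdAddChar_sub_eq_zero hs v.2 u.2 fun h => huv (Subtype.ext h.symm)]
      simp only [w, PiLp.inner_apply, RCLike.inner_apply]
      refine Finset.sum_congr rfl fun i _ => ?_
      rw [sub_eq_add_neg, AddChar.map_add_eq_mul, AddChar.map_neg_eq_conj]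
  simpa using hw.fintype_card_le_finrank

theorem covering_number_diagonal_upper_bound :
    ∀ s : ℕ, 2 ≤ s → R s s ≤ s := by
  intro s hs
  refine csSup_le' ?_
  rintro n ⟨F, hF, rfl⟩
  exact hF.card_le hs
end

section
/- For every even integer s ≥ 2, R(s,s) = 2; that is, the maximum cardinality of a covering family of vectors in (ℤ/sℤ)^s equals 2 when s is even. -/
theorem ZMod.sum_univ_eq_sum_range (s : ℕ) [NeZero s] :
    ∑ a : ZMod s, a = ∑ i ∈ Finset.range s, (i : ZMod s) := by
  refine Finset.sum_nbij' ZMod.val (fun i : ℕ => (i : ZMod s)) ?_ ?_ ?_ ?_ ?_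
  · intro a _
    simpa using ZMod.val_lt a
  · simp
  · simp
  · intro i hi
    exact ZMod.val_natCast_of_lt (Finset.mem_range.mp hi)
  · simp

theorem ZMod.sum_univ_ne_zero_of_even (s : ℕ) [NeZero s] (hs : Even s) :
    ∑ a : ZMod s, a ≠ 0 := by
  rw [ZMod.sum_univ_eq_sum_range, ← Nat.cast_sum, Ne, ZMod.natCast_eq_zero_iff]
  rintro ⟨c, hc⟩
  have hpos : 0 < s := Nat.pos_of_neZero s
  have hsum := Finset.sum_range_id_mul_two s
  rw [hc, mul_assoc] at hsum
  have := Nat.eq_of_mul_eq_mul_left hpos hsum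
  obtain ⟨k, rfl⟩ := hs
  omega

theorem IsCoveringFamily.sum_sub_sum {s : ℕ} [NeZero s] {F : Finset (Fin s → ZMod s)}
    (hF : IsCoveringFamily s s F) {u v : Fin s → ZMod s} (hu : u ∈ F) (hv : v ∈ F)
    (huv : u ≠ v) : ∑ i, u i - ∑ i, v i = ∑ a : ZMod s, a := by
  have hbij : Function.Bijective fun i => u i - v i :=
    (Fintype.bijective_iff_surjective_and_card _).mpr ⟨hF u hu v hv huv, by simp [ZMod.card]⟩
  rw [← Finset.sum_sub_distrib]
  exact hbij.sum_comp fun a => a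

theorem IsCoveringFamily.card_le_two {s : ℕ} [NeZero s] (hs : Even s)
    {F : Finset (Fin s → ZMod s)} (hF : IsCoveringFamily s s F) : F.card ≤ 2 := by
  by_contra! hcard
  obtain ⟨u, v, w, hu, hv, hw, huv, huw, hvw⟩ := Finset.two_lt_card_iff.mp hcard
  apply ZMod.sum_univ_ne_zero_of_even s hs
  linear_combination hF.sum_sub_sum hu hw huw - hF.sum_sub_sum hu hv huv -
    hF.sum_sub_sum hv hw hvw

theorem isCoveringFamily_pair (s : ℕ) [NeZero s] :
    IsCoveringFamily s s {0, fun i : Fin s => ((i : ℕ) : ZMod s)} := by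
  have hsurj (a : ZMod s) : ∃ i : Fin s, ((i : ℕ) : ZMod s) = a :=
    ⟨⟨a.val, a.val_lt⟩, by simp⟩
  intro u hu v hv huv a
  simp only [Finset.mem_insert, Finset.mem_singleton] at hu hv
  rcases hu with rfl | rfl <;> rcases hv with rfl | rfl
  · exact absurd rfl huv
  · obtain ⟨i, hi⟩ := hsurj (-a)
    exact ⟨i, by simp [hi]⟩
  · obtain ⟨i, hi⟩ := hsurj a
    exact ⟨i, by simp [hi]⟩
  · exact absurd rfl huv

theorem covering_number_diagonal_even :
    ∀ s : ℕ, 2 ≤ s → Even s → R s s = 2 := by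
  intro s hs heven
  have : NeZero s := ⟨by omega⟩
  have : Fact (1 < s) := ⟨hs⟩
  refine IsGreatest.csSup_eq ⟨⟨_, isCoveringFamily_pair s, Finset.card_pair fun h => ?_⟩, ?_⟩
  · simpa using congrFun h ⟨1, hs⟩
  · rintro n ⟨F, hF, rfl⟩
    exact hF.card_le_two heven
end

section
/- Let s and q be integers with q ≥ s ≥ 2. If 2(q−s)² < s−1, then R(s,q) ≤ s + 2(q−s) + 2(q−s)². -/
open ComplexConjugate in
/-- Swapping the order of summation: a complex matrix `f` satisfies `‖f fᴴ‖² = ‖fᴴ f‖²` in the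
Frobenius norm. -/
theorem sum_sum_norm_sq_gram_comm {α ι : Type*} [Fintype ι] (F : Finset α) (f : α → ι → ℂ) :
    ∑ u ∈ F, ∑ v ∈ F, ‖∑ i, f u i * conj (f v i)‖ ^ 2 =
      ∑ i, ∑ j, ‖∑ u ∈ F, f u i * conj (f u j)‖ ^ 2 := by
  have key : ((∑ u ∈ F, ∑ v ∈ F, ‖∑ i, f u i * conj (f v i)‖ ^ 2 : ℝ) : ℂ) =
      ((∑ i, ∑ j, ‖∑ u ∈ F, f u i * conj (f u j)‖ ^ 2 : ℝ) : ℂ) := by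
    push_cast
    simp only [← Complex.mul_conj', map_sum, map_mul, Complex.conj_conj, Finset.sum_mul_sum]
    calc _ = ∑ u ∈ F, ∑ i, ∑ j, ∑ v ∈ F,
          f u i * conj (f v i) * (conj (f u j) * f v j) := by
          refine Finset.sum_congr rfl fun u _ => ?_
          rw [Finset.sum_comm]
          exact Finset.sum_congr rfl fun i _ => Finset.sum_comm
      _ = ∑ i, ∑ j, ∑ u ∈ F, ∑ v ∈ F,
          f u i * conj (f v i) * (conj (f u j) * f v j) := by
          rw [Finset.sum_comm]
          exact Finset.sum_congr rfl fun i _ => Finset.sum_comm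
      _ = _ := by
          refine Finset.sum_congr rfl fun i _ => Finset.sum_congr rfl fun j _ =>
            Finset.sum_congr rfl fun u _ => Finset.sum_congr rfl fun v _ => by ring
  exact_mod_cast key

/-- If `d` takes every value of a finite group, then the values of a nontrivial character along
one preimage of each element cancel, so only the excess coordinates contribute. -/
theorem norm_sum_addChar_le_of_surjective {G ι : Type*} [AddCommGroup G] [Fintype G] [Fintype ι]
    {χ : AddChar G ℂ} (hχ : χ ≠ 1) {d : ι → G} (hd : Function.Surjective d) :
    ‖∑ i, χ (d i)‖ ≤ Fintype.card ι - Fintype.card G := by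
  classical
  obtain ⟨g, hg⟩ := hd.hasRightInverse
  set I : Finset ι := Finset.univ.map ⟨g, hg.injective⟩ with hI
  have hsum : ∑ i ∈ I, χ (d i) = 0 := by
    rw [hI, Finset.sum_map]
    simpa [hg _] using AddChar.sum_eq_zero_of_ne_one hχ
  have hcard : (Iᶜ.card : ℝ) + Fintype.card G = Fintype.card ι := by
    have := Finset.card_compl_add_card I
    simp only [hI, Finset.card_map, Finset.card_univ] at this ⊢
    exact_mod_cast this
  rw [← Finset.sum_compl_add_sum I, hsum, add_zero]
  refine (norm_sum_le _ _).trans ?_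
  simp only [AddChar.norm_apply, Finset.sum_const, nsmul_eq_mul, mul_one]
  linarith

open ComplexConjugate in
/-- Double counting of the Gram matrix of the character vectors of a covering family. -/
theorem IsCoveringFamily.mul_card_sq_le {s q : ℕ} (hs : 2 ≤ s) {F : Finset (Fin q → ZMod s)}
    (hF : IsCoveringFamily s q F) :
    (q : ℝ) * F.card ^ 2 ≤ F.card * (q ^ 2 + (F.card - 1) * ((q : ℝ) - s) ^ 2) := by
  classical
  have : NeZero s := ⟨by omega⟩
  have : Fact (1 < s) := ⟨hs⟩
  set χ : AddChar (ZMod s) ℂ := ZMod.stdAddChar with hχ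
  have hχ1 : χ ≠ 1 := by
    intro h
    have h1 : χ 1 = χ 0 := by simp [h]
    exact one_ne_zero (ZMod.injective_stdAddChar h1)
  have hconj (a b : ZMod s) : χ a * conj (χ b) = χ (a - b) := by
    rw [← AddChar.map_neg_eq_conj, ← AddChar.map_add_eq_mul, sub_eq_add_neg]
  have hswap := sum_sum_norm_sq_gram_comm F fun u i => χ (u i)
  simp only [hconj] at hswap
  have lower : (q : ℝ) * F.card ^ 2 ≤
      ∑ i : Fin q, ∑ j : Fin q, ‖∑ u ∈ F, χ (u i - u j)‖ ^ 2 := by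
    calc (q : ℝ) * F.card ^ 2 = ∑ i : Fin q, ‖∑ u ∈ F, χ (u i - u i)‖ ^ 2 := by simp
      _ ≤ _ := Finset.sum_le_sum fun i _ =>
        Finset.single_le_sum (f := fun j => ‖∑ u ∈ F, χ (u i - u j)‖ ^ 2)
          (fun _ _ => by positivity) (Finset.mem_univ i)
  have upper : ∑ u ∈ F, ∑ v ∈ F, ‖∑ i, χ (u i - v i)‖ ^ 2 ≤
      F.card * (q ^ 2 + (F.card - 1) * ((q : ℝ) - s) ^ 2) := by
    rw [← nsmul_eq_mul]
    refine Finset.sum_le_card_nsmul _ _ _ fun u hu => ?_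
    rw [← Finset.add_sum_erase F _ hu]
    refine add_le_add (by simp) ?_
    have hcard : ((F.erase u).card : ℝ) = F.card - 1 := by
      rw [Finset.card_erase_of_mem hu, Nat.cast_pred (Finset.card_pos.mpr ⟨u, hu⟩)]
    rw [← hcard, ← nsmul_eq_mul]
    refine Finset.sum_le_card_nsmul _ _ _ fun v hv => ?_
    obtain ⟨hvu, hv⟩ := Finset.mem_erase.mp hv
    have := norm_sum_addChar_le_of_surjective hχ1
      (d := fun i => u i - v i) (hF u hu v hv hvu.symm)
    simp only [Fintype.card_fin, ZMod.card] at this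
    gcongr
  exact lower.trans (hswap ▸ upper)

theorem covering_number_near_diagonal_upper_bound :
    ∀ s q : ℕ, 2 ≤ s → s ≤ q → 2 * (q - s) ^ 2 < s - 1 →
      R s q ≤ s + 2 * (q - s) + 2 * (q - s) ^ 2 := by
  intro s q hs hsq hlt
  obtain ⟨t, rfl⟩ := Nat.exists_eq_add_of_le hsq
  rw [Nat.add_sub_cancel_left] at hlt ⊢
  refine csSup_le' ?_
  rintro _ ⟨F, hF, rfl⟩
  by_contra! hN
  have hbound := hF.mul_card_sq_le hs
  have hs' : 2 * (t : ℝ) ^ 2 + 2 ≤ s := by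
    have : 2 * t ^ 2 + 2 ≤ s := by omega
    exact_mod_cast this
  have hN' : (s : ℝ) + 2 * t + 2 * t ^ 2 + 1 ≤ F.card := by exact_mod_cast hN
  have ht : (0 : ℝ) ≤ t := t.cast_nonneg
  push_cast at hbound
  rw [add_sub_cancel_left] at hbound
  generalize (F.card : ℝ) = N at *
  generalize (s : ℝ) = x at *
  generalize (t : ℝ) = y at *
  have hNpos : 0 < N := by nlinarith
  have hlin : (x + y) * N ≤ (x + y) ^ 2 + (N - 1) * y ^ 2 :=
    le_of_mul_le_mul_left (by linarith) hNpos
  have hgap : 0 ≤ x + y - y ^ 2 := by nlinarith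
  have hmul := mul_le_mul_of_nonneg_right hN' hgap
  have hmul' := mul_le_mul_of_nonneg_right hs' (by positivity : 0 ≤ y + y ^ 2 + 1)
  have hy3 : 0 ≤ y ^ 3 := by positivity
  nlinarith
end

section
/- For every real constant C with 1 < C < log₂ e there exists a real ε = ε(C) > 0 such that for all integers s ≥ 2 and q with s ≤ q < C·s, one has R(s,q) ≤ (2−ε)^q. -/
open Polynomial in
/-- If the roots of a monic product of `q` linear factors include `s` distinct `s`-th roots of
unity, then its coefficients of index strictly between `q - s` and `s` vanish. -/
theorem Polynomial.coeff_prod_X_sub_C_eq_zero_of_rootsOfUnity {K : Type*} [Field K] {s q j : ℕ}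
    (w : Fin q → K) (z : Fin s → K) (hz : Function.Injective z) (hz1 : ∀ a, z a ^ s = 1)
    (hw : ∀ a, ∃ i, w i = z a) (h1 : q - s < j) (h2 : j < s) :
    (∏ i, (X - C (w i))).coeff j = 0 := by
  set P : K[X] := ∏ i, (X - C (w i)) with hP
  have hs : s ≠ 0 := by omega
  have hM : (X ^ s - 1 : K[X]).Monic := by simpa using monic_X_pow_sub_C (1 : K) hs
  have hMdeg : (X ^ s - 1 : K[X]).natDegree = s := by
    simpa using natDegree_X_pow_sub_C (n := s) (r := (1 : K))
  have hM1 : (X ^ s - 1 : K[X]) ≠ 1 := by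
    intro h
    rw [h, natDegree_one] at hMdeg
    exact hs hMdeg.symm
  have hPz (a) : P.eval (z a) = 0 := by
    obtain ⟨i, hi⟩ := hw a
    rw [hP, eval_prod]
    exact Finset.prod_eq_zero (Finset.mem_univ i) (by simp [hi])
  have hPdeg : P.natDegree = q := by simp [hP]
  have hrem : P %ₘ (X ^ s - 1) = 0 := by
    refine eq_zero_of_natDegree_lt_card_of_eval_eq_zero _ hz (fun a => ?_) ?_
    · have h := congrArg (eval (z a)) (modByMonic_add_div P (X ^ s - 1))
      simpa [hPz, hz1] using h
    · simpa [hMdeg] using natDegree_modByMonic_lt P hM hM1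
  have hdiv := modByMonic_add_div P (X ^ s - 1)
  have hQ : (P /ₘ (X ^ s - 1)).coeff j = 0 := by
    apply coeff_eq_zero_of_natDegree_lt
    rwa [natDegree_divByMonic _ hM, hPdeg, hMdeg]
  rw [hrem, zero_add, sub_mul, one_mul] at hdiv
  rw [← hdiv, coeff_sub, hQ, coeff_X_pow_mul', if_neg (by omega), sub_zero]

/-- Vectors admitting a biorthogonal system are at most as many as the coordinates. -/
theorem Finset.card_le_card_of_biorthogonal {K V T : Type*} [Field K] [Fintype T] (F : Finset V)
    (φ ψ : V → T → K) (hdiag : ∀ u ∈ F, ∑ t, φ u t * ψ u t ≠ 0)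
    (hoff : ∀ u ∈ F, ∀ v ∈ F, u ≠ v → ∑ t, φ u t * ψ v t = 0) :
    F.card ≤ Fintype.card T := by
  have hli : LinearIndependent K (fun u : F => φ u) := by
    rw [Fintype.linearIndependent_iff]
    intro g hg v
    have h : ∑ t, (∑ u : F, g u • φ u) t * ψ v t = 0 := by rw [hg]; simp
    simp only [Finset.sum_apply, Pi.smul_apply, smul_eq_mul, Finset.sum_mul, mul_assoc] at h
    rw [Finset.sum_comm] at h
    simp only [← Finset.mul_sum] at h
    rw [Finset.sum_eq_single v (fun u _ huv => by
      rw [hoff u u.2 v v.2 (fun h => huv (Subtype.ext h)), mul_zero]) (by simp)] at h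
    exact (mul_eq_zero.mp h).resolve_right (hdiag v v.2)
  simpa using hli.fintype_card_le_finrank

open Polynomial in
theorem IsCoveringFamily.card_le_choose {s q j : ℕ} {F : Finset (Fin q → ZMod s)}
    (hF : IsCoveringFamily s q F) (h1 : q - s < j) (h2 : j < s) (hjq : j ≤ q) :
    F.card ≤ q.choose (q - j) := by
  have : NeZero s := ⟨by omega⟩
  let χ : AddChar (ZMod s) ℂ := ZMod.stdAddChar
  let e : Fin s ≃ ZMod s := Fintype.equivOfCardEq (by simp [ZMod.card])
  let T := {t // t ∈ Finset.powersetCard (q - j) (Finset.univ : Finset (Fin q))}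
  let φ : (Fin q → ZMod s) → T → ℂ := fun u t => ∏ i ∈ t.1, -χ (u i)
  let ψ : (Fin q → ZMod s) → T → ℂ := fun v t => ∏ i ∈ t.1, χ (-v i)
  have hsum (u v) : ∑ t, φ u t * ψ v t =
      ∑ t ∈ Finset.powersetCard (q - j) (Finset.univ : Finset (Fin q)),
        ∏ i ∈ t, -χ (u i - v i) := by
    rw [← Finset.sum_coe_sort (Finset.powersetCard (q - j) (Finset.univ : Finset (Fin q)))
      (fun t => ∏ i ∈ t, -χ (u i - v i))]
    refine Finset.sum_congr rfl fun t _ => ?_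
    simp only [φ, ψ, ← Finset.prod_mul_distrib]
    refine Finset.prod_congr rfl fun i _ => ?_
    rw [sub_eq_add_neg, AddChar.map_add_eq_mul, neg_mul]
  have h := F.card_le_card_of_biorthogonal φ ψ ?_ ?_
  · simpa [T] using h
  · intro u _
    rw [hsum, Finset.sum_congr rfl (g := fun _ => (-1 : ℂ) ^ (q - j))]
    · simp [Nat.choose_eq_zero_iff]
    · intro t ht
      simp [(Finset.mem_powersetCard.mp ht).2]
  · intro u hu v hv huv
    rw [hsum]
    have hcoeff := Finset.prod_X_add_C_coeff (Finset.univ : Finset (Fin q))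
      (fun i => -χ (u i - v i)) (k := j) (by simpa using hjq)
    rw [Finset.card_univ, Fintype.card_fin] at hcoeff
    rw [← hcoeff]
    simp only [map_neg, ← sub_eq_add_neg]
    refine coeff_prod_X_sub_C_eq_zero_of_rootsOfUnity (s := s) _ (fun a => χ (e a))
      (ZMod.injective_stdAddChar.comp e.injective) (fun a => ?_) (fun a => ?_) h1 h2
    · rw [← AddChar.map_nsmul_eq_pow]
      simp
    · obtain ⟨i, hi⟩ := hF u hu v hv huv (e a)
      exact ⟨i, by rw [hi]⟩

theorem R_le_of_forall_card_le {s q B : ℕ}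
    (h : ∀ F : Finset (Fin q → ZMod s), IsCoveringFamily s q F → F.card ≤ B) : R s q ≤ B := by
  refine csSup_le ⟨0, ∅, by simp [IsCoveringFamily], rfl⟩ ?_
  rintro n ⟨F, hF, rfl⟩
  exact h F hF

theorem Nat.choose_le_pow_of_twelve_mul_le {q k : ℕ} (hkq : k ≤ q) (h : 12 * k ≤ 5 * q) :
    (q.choose k : ℝ) ≤ (2 - 1 / 50) ^ q := by
  let y : ℝ := 49 / 50
  have hterm : (y ^ 12) ^ k * (q.choose k : ℝ) ≤ (y ^ 12 + 1) ^ q := by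
    rw [add_pow]
    have := Finset.single_le_sum (f := fun m => (y ^ 12) ^ m * 1 ^ (q - m) * (q.choose m : ℝ))
      (s := Finset.range (q + 1)) (fun m _ => by positivity)
      (Finset.mem_range.mpr (Nat.lt_succ_of_le hkq))
    simpa using this
  have hpow : (y ^ 5) ^ q ≤ (y ^ 12) ^ k := by
    rw [← pow_mul, ← pow_mul]
    exact pow_le_pow_of_le_one (by norm_num [y]) (by norm_num [y]) h
  have hbase : (y ^ 12 + 1) ^ q ≤ ((2 - 1 / 50) * y ^ 5) ^ q :=
    pow_le_pow_left₀ (by positivity) (by norm_num [y]) q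
  rw [mul_pow] at hbase
  have hpos : 0 < (y ^ 5) ^ q := by positivity
  refine le_of_mul_le_mul_left ?_ hpos
  calc (y ^ 5) ^ q * (q.choose k : ℝ) ≤ (y ^ 12) ^ k * (q.choose k : ℝ) := by gcongr
    _ ≤ _ := hterm
    _ ≤ _ := hbase
    _ = _ := mul_comm _ _

theorem Real.logb_two_exp_one_lt : Real.logb 2 (Real.exp 1) < 3 / 2 := by
  have h := Real.log_two_gt_d9
  rw [Real.logb, Real.log_exp, div_lt_iff₀ (by linarith)]
  linarith

theorem covering_number_exponential_upper_bound :
    ∀ C : ℝ, 1 < C → C < Real.logb 2 (Real.exp 1) →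
      ∃ ε : ℝ, 0 < ε ∧ ∀ s q : ℕ, 2 ≤ s → s ≤ q → (q : ℝ) < C * (s : ℝ) →
        (R s q : ℝ) ≤ (2 - ε) ^ q := by
  intro C _ hC
  refine ⟨1 / 50, by norm_num, fun s q hs hsq hq => ?_⟩
  have hqs : 2 * q < 3 * s := by
    have hs0 : (0 : ℝ) < s := by positivity
    have hlt : C * s < 3 / 2 * s := by
      gcongr
      exact hC.trans Real.logb_two_exp_one_lt
    have : (2 * q : ℝ) < 3 * s := by linarith
    exact_mod_cast this
  have hR : R s q ≤ q.choose (q - (s - 1)) :=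
    R_le_of_forall_card_le fun F hF => hF.card_le_choose (by omega) (by omega) (by omega)
  refine (Nat.cast_le.mpr hR).trans ?_
  rcases le_or_gt 8 q with h8 | h8
  · exact Nat.choose_le_pow_of_twelve_mul_le (by omega) (by omega)
  · clear hR hq
    interval_cases q <;> interval_cases s <;> first | omega | norm_num [Nat.choose]
end

section
/- For every integer q ≥ 1, the family of all vectors in (ℤ/3ℤ)^q whose first coordinate equals 0, exactly ⌊q/2⌋ of whose coordinates equal 1, and all of whose remaining coordinates equal 0, is a covering family; consequently R(3,q) ≥ C(q−1, ⌊q/2⌋), the binomial coefficient (q−1 choose ⌊q/2⌋). -/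
theorem exists_eq_one_and_eq_zero {s q : ℕ} [DecidableEq (ZMod s)] {u v : Fin q → ZMod s}
    (hu : ∀ i, u i = 0 ∨ u i = 1) (hv : ∀ i, v i = 0 ∨ v i = 1)
    (hcard : (Finset.univ.filter (fun i => u i = 1)).card =
      (Finset.univ.filter (fun i => v i = 1)).card)
    (hne : u ≠ v) : ∃ i, u i = 1 ∧ v i = 0 := by
  by_contra! h
  have hsub : Finset.univ.filter (fun i => u i = 1) ⊆ Finset.univ.filter (fun i => v i = 1) := by
    intro i hi
    simp only [Finset.mem_filter, Finset.mem_univ, true_and] at hi ⊢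
    exact (hv i).resolve_left (h i hi)
  have heq := Finset.eq_of_subset_of_card_le hsub hcard.ge
  refine hne (funext fun i => ?_)
  have hi : u i = 1 ↔ v i = 1 := by simpa using Finset.ext_iff.mp heq i
  rcases hu i with h0 | h1
  · rcases hv i with h0' | h1'
    · rw [h0, h0']
    · rw [hi.mpr h1', h1']
  · rw [h1, hi.mp h1]

theorem IsCoveringFamily.card_le_R {s q : ℕ} [NeZero s] {F : Finset (Fin q → ZMod s)}
    (hF : IsCoveringFamily s q F) : F.card ≤ R s q := by
  refine le_csSup ⟨Fintype.card (Fin q → ZMod s), ?_⟩ ⟨F, hF, rfl⟩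
  rintro n ⟨G, -, rfl⟩
  exact Finset.card_le_univ G

open Classical in
theorem choose_le_card_filter_indicator (q k : ℕ) (hq : 1 ≤ q) :
    (q - 1).choose k ≤ (Finset.univ.filter (fun v : Fin q → ZMod 3 =>
      v ⟨0, hq⟩ = 0 ∧ (∀ i : Fin q, v i = 0 ∨ v i = 1) ∧
      (Finset.univ.filter (fun i : Fin q => v i = 1)).card = k)).card := by
  have hcard : (Finset.powersetCard k (Finset.univ.erase (⟨0, hq⟩ : Fin q))).card =
      (q - 1).choose k := by simp
  rw [← hcard]
  refine Finset.card_le_card_of_injOn (fun S i => if i ∈ S then 1 else 0) ?_ ?_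
  · intro S hS
    have hS' := Finset.mem_powersetCard.mp hS
    have h0 : (⟨0, hq⟩ : Fin q) ∉ S := fun h => Finset.notMem_erase _ _ (hS'.1 h)
    simp only [Finset.coe_filter, Set.mem_ofPred_eq, Finset.mem_univ, true_and]
    refine ⟨if_neg h0, fun i => ?_, ?_⟩
    · by_cases h : i ∈ S <;> simp [h]
    · simpa using hS'.2
  · intro S _ T _ h
    ext i
    have hi := congrFun h i
    by_cases hS : i ∈ S <;> by_cases hT : i ∈ T <;> simp_all

open Classical in
theorem covering_number_three_lower_bound (q : ℕ) (hq : 1 ≤ q) :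
    IsCoveringFamily 3 q
      (Finset.univ.filter (fun v : Fin q → ZMod 3 =>
        v ⟨0, hq⟩ = 0 ∧ (∀ i : Fin q, v i = 0 ∨ v i = 1) ∧
        (Finset.univ.filter (fun i : Fin q => v i = 1)).card = q / 2)) ∧
    (q - 1).choose (q / 2) ≤ R 3 q := by
  have hcov : IsCoveringFamily 3 q
      (Finset.univ.filter (fun v : Fin q → ZMod 3 =>
        v ⟨0, hq⟩ = 0 ∧ (∀ i : Fin q, v i = 0 ∨ v i = 1) ∧
        (Finset.univ.filter (fun i : Fin q => v i = 1)).card = q / 2)) := by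
    intro u hu v hv hne a
    simp only [Finset.mem_filter, Finset.mem_univ, true_and] at hu hv
    obtain ⟨hu0, hu1, hu2⟩ := hu
    obtain ⟨hv0, hv1, hv2⟩ := hv
    have ha : a = 0 ∨ a = 1 ∨ a = -1 := by revert a; decide
    rcases ha with rfl | rfl | rfl
    · exact ⟨⟨0, hq⟩, by rw [hu0, hv0, sub_zero]⟩
    · obtain ⟨i, hi, hi'⟩ := exists_eq_one_and_eq_zero hu1 hv1 (by convert hu2.trans hv2.symm) hne
      exact ⟨i, by rw [hi, hi', sub_zero]⟩
    · obtain ⟨i, hi, hi'⟩ :=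
        exists_eq_one_and_eq_zero hv1 hu1 (by convert hv2.trans hu2.symm) hne.symm
      exact ⟨i, by rw [hi, hi', zero_sub]⟩
  exact ⟨hcov, (choose_le_card_filter_indicator q (q / 2) hq).trans hcov.card_le_R⟩
end

section
/- For every even integer s ≥ 2 and every integer q ≥ 1, R(s,q) · Σ_{i=0}^{⌊(s−1)/4⌋} C(q,i) ≤ 2^q, where C(q,i) denotes the binomial coefficient. (This follows since reducing the vectors of a covering family in (ℤ/sℤ)^q modulo 2 yields binary vectors any two of which differ in at least s/2 coordinates, so the Hamming balls of radius ⌊(s−1)/4⌋ around them are pairwise disjoint.) -/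
open Finset in
/-- The Hamming sphere of radius `k` in `(ZMod 2)^ι` has `(card ι).choose k` points. -/
theorem card_hammingSphere_zmod_two {ι : Type*} [Fintype ι] [DecidableEq ι]
    (w : ι → ZMod 2) (k : ℕ) :
    #{x : ι → ZMod 2 | hammingDist w x = k} = (Fintype.card ι).choose k := by
  have two : ∀ a b : ZMod 2, a ≠ b → a + 1 = b := by decide
  rw [← card_univ, ← card_powersetCard]
  refine card_nbij' (fun x => ({i | w i ≠ x i} : Finset ι))
    (fun T i => if i ∈ T then w i + 1 else w i) ?_ ?_ ?_ ?_
  · intro x hx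
    simpa [hammingDist] using hx
  · intro T hT
    simpa [hammingDist] using hT
  · intro x _
    funext i
    by_cases h : w i = x i
    · simp [h]
    · simp [h, two _ _ h]
  · intro T _
    ext i
    simp

open Finset in
/-- The cardinality of a Hamming ball of radius `t` in `(ZMod 2)^ι`. -/
theorem card_hammingBall_zmod_two {ι : Type*} [Fintype ι] [DecidableEq ι]
    (w : ι → ZMod 2) (t : ℕ) :
    #{x : ι → ZMod 2 | hammingDist w x ≤ t} =
      ∑ i ∈ range (t + 1), (Fintype.card ι).choose i := by
  rw [card_eq_sum_card_fiberwise (f := hammingDist w) (t := range (t + 1))]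
  · refine sum_congr rfl fun k hk => ?_
    rw [← card_hammingSphere_zmod_two w k, filter_filter]
    congr 1
    ext x
    simp only [mem_range, mem_filter, mem_univ, true_and] at hk ⊢
    omega
  · intro x hx
    simpa [Nat.lt_succ_iff] using hx

open Finset in
/-- The Hamming bound for a family of binary vectors with pairwise distances exceeding `2 * t`. -/
theorem card_mul_sum_choose_le_two_pow {ι α : Type*} [Fintype ι] [DecidableEq ι]
    (F : Finset α) (f : α → ι → ZMod 2) (t : ℕ)
    (hf : ∀ u ∈ F, ∀ v ∈ F, u ≠ v → 2 * t < hammingDist (f u) (f v)) :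
    #F * ∑ i ∈ range (t + 1), (Fintype.card ι).choose i ≤ 2 ^ Fintype.card ι := by
  have hdisj : (F : Set α).PairwiseDisjoint
      fun u => ({x : ι → ZMod 2 | hammingDist (f u) x ≤ t} : Finset (ι → ZMod 2)) := by
    intro u hu v hv huv
    refine disjoint_left.2 fun x hxu hxv => ?_
    have hdist := hf u hu v hv huv
    have htri := hammingDist_triangle_right (f u) (f v) x
    simp only [mem_filter, mem_univ, true_and] at hxu hxv
    omega
  calc #F * ∑ i ∈ range (t + 1), (Fintype.card ι).choose i
      = #(F.disjiUnion _ hdisj) := by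
        simp only [card_disjiUnion, card_hammingBall_zmod_two, sum_const, smul_eq_mul]
    _ ≤ Fintype.card (ι → ZMod 2) := card_le_univ _
    _ = 2 ^ Fintype.card ι := by simp

/-- Distinct members of a covering family over `ZMod (m + m)` differ modulo 2 in at least `m`
coordinates. -/
theorem IsCoveringFamily.le_hammingDist_castHom {m q : ℕ} (hm : 2 ∣ m + m)
    {F : Finset (Fin q → ZMod (m + m))} (hF : IsCoveringFamily (m + m) q F)
    {u v : Fin q → ZMod (m + m)} (hu : u ∈ F) (hv : v ∈ F) (huv : u ≠ v) :
    m ≤ hammingDist (fun i => ZMod.castHom hm (ZMod 2) (u i))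
      (fun i => ZMod.castHom hm (ZMod 2) (v i)) := by
  choose c hc using fun j : Fin m => hF u hu v hv huv ((2 * (j : ℕ) + 1 : ℕ) : ZMod (m + m))
  have hinj : Function.Injective c := by
    intro j k hjk
    have h := (hc j).symm.trans (hjk ▸ hc k)
    rw [ZMod.natCast_eq_natCast_iff', Nat.mod_eq_of_lt (by omega),
      Nat.mod_eq_of_lt (by omega)] at h
    exact Fin.ext (by omega)
  calc m = (Finset.univ.image c).card := by
        rw [Finset.card_image_of_injective _ hinj, Finset.card_fin]
    _ ≤ _ := by
        refine Finset.card_le_card fun i hi => ?_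
        obtain ⟨j, -, rfl⟩ := Finset.mem_image.1 hi
        refine Finset.mem_filter.2 ⟨Finset.mem_univ _, fun h => ?_⟩
        have hodd := congrArg (ZMod.castHom hm (ZMod 2)) (hc j)
        rw [map_sub, sub_eq_zero.2 h, map_natCast, eq_comm,
          ZMod.natCast_eq_zero_iff] at hodd
        omega

/-- The maximum defining `R s q` is attained. -/
theorem exists_isCoveringFamily_card_eq_R (s q : ℕ) [NeZero s] :
    ∃ F : Finset (Fin q → ZMod s), IsCoveringFamily s q F ∧ F.card = R s q := by
  refine Nat.sSup_mem (s := {n : ℕ | ∃ F : Finset (Fin q → ZMod s),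
    IsCoveringFamily s q F ∧ F.card = n}) ⟨0, ∅, by simp [IsCoveringFamily], rfl⟩
    ⟨Fintype.card (Fin q → ZMod s), ?_⟩
  rintro _ ⟨F, -, rfl⟩
  exact Finset.card_le_univ F

theorem covering_number_even_hamming_bound :
    ∀ s q : ℕ, 2 ≤ s → Even s → 1 ≤ q →
      R s q * (∑ i ∈ Finset.range ((s - 1) / 4 + 1), q.choose i) ≤ 2 ^ q := by
  rintro s q hs ⟨m, rfl⟩ -
  have : NeZero (m + m) := ⟨by omega⟩
  have hm : 2 ∣ m + m := ⟨m, by omega⟩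
  obtain ⟨F, hF, hcard⟩ := exists_isCoveringFamily_card_eq_R (m + m) q
  have h := card_mul_sum_choose_le_two_pow F
    (fun u i => ZMod.castHom hm (ZMod 2) (u i)) ((m + m - 1) / 4) fun u hu v hv huv => by
      have hdist := hF.le_hammingDist_castHom hm hu hv huv
      omega
  rwa [Fintype.card_fin, hcard] at h
end
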